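/- arXiv:1601.02226 — 2 statements merged into one kernel-verified Lean document; each statement's English description precedes it below -/
import Mathlib

section
/- The determinant of the Jacobian matrix (∂hᵢ/∂xⱼ) of the map h equals 2·ρ₁(x)ρ₂(x)ρ₃(x) as a polynomial identity in (x₁,x₂,x₃), and the determinant of the Jacobian matrix (∂fᵢ/∂xⱼ) of the map f equals 16·x₁x₂x₃·(ρ₁(x)ρ₂(x)ρ₃(x))². (This identifies the critical divisor of the rational map f of ℙ² as supported on the three lines Aᵢ = {ρᵢ = 0} and the three coordinate lines Xⱼ = {xⱼ = 0}.) -/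
/-- ρ₁(x) = −x₁ + x₂ + x₃ -/
def rho1 (x : Fin 3 → ℂ) : ℂ := -x 0 + x 1 + x 2
/-- ρ₂(x) = x₁ − x₂ + x₃ -/
def rho2 (x : Fin 3 → ℂ) : ℂ := x 0 - x 1 + x 2
/-- ρ₃(x) = x₁ + x₂ − x₃ -/
def rho3 (x : Fin 3 → ℂ) : ℂ := x 0 + x 1 - x 2
/-- Homogeneous representative of the Cremona-type involution h. -/
def hmap (x : Fin 3 → ℂ) : Fin 3 → ℂ :=
  ![x 0 * rho1 x, x 1 * rho2 x, x 2 * rho3 x]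
/-- Homogeneous representative of the rational map f = g∘h. -/
def fmap (x : Fin 3 → ℂ) : Fin 3 → ℂ :=
  ![x 0 ^ 2 * rho1 x ^ 2, x 1 ^ 2 * rho2 x ^ 2, x 2 ^ 2 * rho3 x ^ 2]

/-- The Jacobian matrix (∂gᵢ/∂xⱼ) of a map g : ℂ³ → ℂ³ at x. -/
noncomputable def jacobian (g : (Fin 3 → ℂ) → (Fin 3 → ℂ)) (x : Fin 3 → ℂ) :
    Matrix (Fin 3) (Fin 3) ℂ :=
  Matrix.of fun i j => fderiv ℂ (fun y => g y i) x (Pi.single j 1)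

theorem hasFDerivAt_coord (x : Fin 3 → ℂ) (i : Fin 3) :
    HasFDerivAt (fun y : Fin 3 → ℂ => y i) (ContinuousLinearMap.proj (R := ℂ) (φ := fun _ : Fin 3 => ℂ) i) x :=
  (ContinuousLinearMap.proj (R := ℂ) (φ := fun _ : Fin 3 => ℂ) i).hasFDerivAt

theorem fderiv_h (x v : Fin 3 → ℂ) (i : Fin 3) (a b c : ℂ) :
    fderiv ℂ (fun y : Fin 3 → ℂ => y i * (a * y 0 + b * y 1 + c * y 2)) x v =
      v i * (a * x 0 + b * x 1 + c * x 2) + x i * (a * v 0 + b * v 1 + c * v 2) := by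
  have h := (hasFDerivAt_coord x i).mul ((((hasFDerivAt_coord x 0).const_mul a).add
    ((hasFDerivAt_coord x 1).const_mul b)).add ((hasFDerivAt_coord x 2).const_mul c))
  have h2 := congrArg (fun L => L v) h.fderiv
  refine Eq.trans h2 ?_
  simp
  ring

theorem fderiv_f (x v : Fin 3 → ℂ) (i : Fin 3) (a b c : ℂ) :
    fderiv ℂ (fun y : Fin 3 → ℂ => (y i * (a * y 0 + b * y 1 + c * y 2)) ^ 2) x v =
      2 * (x i * (a * x 0 + b * x 1 + c * x 2)) *
      (v i * (a * x 0 + b * x 1 + c * x 2) + x i * (a * v 0 + b * v 1 + c * v 2)) := by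
  have h := ((hasFDerivAt_coord x i).mul ((((hasFDerivAt_coord x 0).const_mul a).add
    ((hasFDerivAt_coord x 1).const_mul b)).add ((hasFDerivAt_coord x 2).const_mul c))).pow 2
  have h2 := congrArg (fun L => L v) h.fderiv
  refine Eq.trans h2 ?_
  simp
  ring

/-- det Jac(h) = 2·ρ₁ρ₂ρ₃ and det Jac(f) = 16·x₁x₂x₃·(ρ₁ρ₂ρ₃)². -/
theorem stmt_6 (x : Fin 3 → ℂ) :
    (jacobian hmap x).det = 2 * (rho1 x * rho2 x * rho3 x) ∧
    (jacobian fmap x).det = 16 * (x 0 * x 1 * x 2) * (rho1 x * rho2 x * rho3 x) ^ 2 := by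
  have h0 : (fun y => hmap y 0) = fun y => y 0 * ((-1) * y 0 + 1 * y 1 + 1 * y 2) := by
    funext y; simp [hmap, rho1]
  have h1 : (fun y => hmap y 1) = fun y => y 1 * (1 * y 0 + (-1) * y 1 + 1 * y 2) := by
    funext y; simp [hmap, rho2]; left; ring
  have h2 : (fun y => hmap y 2) = fun y => y 2 * (1 * y 0 + 1 * y 1 + (-1) * y 2) := by
    funext y; simp [hmap, rho3]; left; ring
  have f0 : (fun y => fmap y 0) = fun y => (y 0 * ((-1) * y 0 + 1 * y 1 + 1 * y 2)) ^ 2 := by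
    funext y; simp [fmap, rho1]; ring
  have f1 : (fun y => fmap y 1) = fun y => (y 1 * (1 * y 0 + (-1) * y 1 + 1 * y 2)) ^ 2 := by
    funext y; simp [fmap, rho2]; ring
  have f2 : (fun y => fmap y 2) = fun y => (y 2 * (1 * y 0 + 1 * y 1 + (-1) * y 2)) ^ 2 := by
    funext y; simp [fmap, rho3]; ring
  constructor
  · rw [Matrix.det_fin_three]
    simp only [jacobian, Matrix.of_apply, h0, h1, h2, fderiv_h]
    simp [rho1, rho2, rho3]
    ring
  · rw [Matrix.det_fin_three]
    simp only [jacobian, Matrix.of_apply, f0, f1, f2, fderiv_f]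
    simp [rho1, rho2, rho3]
    ring
end

section
/- Let t ∈ (0,1) and let x = (x₁,x₂,x₃) ∈ ℝ³ be nonzero with ρ(x) ≤ 0. Then x₁+x₂+x₃ ≠ 0, and ρ(T_{1/t}(x)) < 0, where for s ∈ ℝ the linear map T_s : ℝ³ → ℝ³ is T_s(x) = x − ((1−s)/3)(x₁+x₂+x₃)·(1,1,1). (Since T_{1/t} is the inverse of T_t, this expresses that the closure of the region U = {ρ < 0} in ℝℙ² is contained in T_t(U) for every t ∈ (0,1).) -/
/-- ρ(x) = x₁² + x₂² + x₃² − 2(x₁x₂ + x₂x₃ + x₃x₁) -/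
def rho (x : ℝ × ℝ × ℝ) : ℝ :=
  x.1 ^ 2 + x.2.1 ^ 2 + x.2.2 ^ 2 - 2 * (x.1 * x.2.1 + x.2.1 * x.2.2 + x.2.2 * x.1)

/-- T_s(x) = x − ((1−s)/3)(x₁+x₂+x₃)·(1,1,1). -/
noncomputable def Tmap (s : ℝ) (x : ℝ × ℝ × ℝ) : ℝ × ℝ × ℝ :=
  x - ((1 - s) / 3 * (x.1 + x.2.1 + x.2.2)) • ((1 : ℝ), (1 : ℝ), (1 : ℝ))

/-- For t ∈ (0,1) and nonzero real x with ρ(x) ≤ 0: x₁+x₂+x₃ ≠ 0 and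
ρ(T_{1/t}(x)) < 0, i.e. the closure of U = {ρ < 0} is contained in T_t(U). -/
theorem stmt_12 (t : ℝ) (ht : t ∈ Set.Ioo (0 : ℝ) 1) (x : ℝ × ℝ × ℝ)
    (hx : x ≠ 0) (hρ : rho x ≤ 0) :
    x.1 + x.2.1 + x.2.2 ≠ 0 ∧ rho (Tmap (1 / t) x) < 0 := by
  obtain ⟨a, b, c⟩ := x
  have hS : a + b + c ≠ 0 := by
    intro h
    apply hx
    simp only [rho] at hρ
    have h0 : (a + b + c) ^ 2 = 0 := by rw [h]; ring
    have ha : a ^ 2 = 0 := by nlinarith [sq_nonneg a, sq_nonneg b, sq_nonneg c]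
    have hb : b ^ 2 = 0 := by nlinarith [sq_nonneg a, sq_nonneg b, sq_nonneg c]
    have hc : c ^ 2 = 0 := by nlinarith [sq_nonneg a, sq_nonneg b, sq_nonneg c]
    have ha' : a = 0 := by simpa using ha
    have hb' : b = 0 := by simpa using hb
    have hc' : c = 0 := by simpa using hc
    subst ha' hb' hc'
    rfl
  refine ⟨hS, ?_⟩
  have hs : 1 < 1 / t := by
    rw [lt_div_iff₀ ht.1]
    linarith [ht.2]
  generalize 1 / t = s at hs
  have key : rho (Tmap s (a, b, c)) = rho (a, b, c) - (s ^ 2 - 1) * (a + b + c) ^ 2 / 3 := by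
    simp [rho, Tmap]
    ring
  have h1 : 0 < (a + b + c) ^ 2 := by positivity
  have h2 : 0 < s ^ 2 - 1 := by nlinarith
  have h3 := mul_pos h2 h1
  rw [key]
  linarith
end
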